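/- arXiv:2006.03345 — 6 statements merged into one kernel-verified Lean document; each statement's English description precedes it below -/
import Mathlib

section
/- Let m>0, ω∈(−m,m), α>0, and let f:ℝ→ℝ. Define the spinor profile φ(x)=(v(x),u(x)) with v(x)=α e^{−ϰ(ω)|x|} and u(x)=α μ(ω) (sgn x) e^{−ϰ(ω)|x|}. Then: (i) for every x≠0 one has (m−ω)v(x)+u'(x)=0 and −v'(x)−(m+ω)u(x)=0 (i.e. φ solves the stationary Dirac system D_m φ = ω φ away from the origin); and (ii) the jump condition iσ₂[φ]₀ = f(φ̂*σ₃φ̂) σ₃ φ̂ holds, where [φ]₀=φ(0⁺)−φ(0⁻)=(0,2αμ(ω)) and φ̂=½(φ(0⁺)+φ(0⁻))=(α,0), if and only if f(α²)=2μ(ω). -/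
theorem hasDerivAt_exp_neg_mul_abs (k : ℝ) {x : ℝ} (hx : x ≠ 0) :
    HasDerivAt (fun y : ℝ => Real.exp (-(k * |y|)))
      (-(k * Real.sign x) * Real.exp (-(k * |x|))) x := by
  have h : HasDerivAt (fun y : ℝ => |y|) (Real.sign x) x := by
    rcases hx.lt_or_gt with h | h
    · rw [Real.sign_of_neg h]
      exact hasDerivAt_abs_neg h
    · rw [Real.sign_of_pos h]
      exact hasDerivAt_abs_pos h
  rw [mul_comm]
  exact (h.const_mul k).neg.exp

theorem Real.sign_eventuallyEq {x : ℝ} (hx : x ≠ 0) :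
    Real.sign =ᶠ[nhds x] fun _ => Real.sign x := by
  rcases hx.lt_or_gt with h | h
  · filter_upwards [eventually_lt_nhds h] with y hy
    rw [Real.sign_of_neg hy, Real.sign_of_neg h]
  · filter_upwards [eventually_gt_nhds h] with y hy
    rw [Real.sign_of_pos hy, Real.sign_of_pos h]

theorem Real.mul_sqrt_div_self {a b : ℝ} (ha : 0 < a) :
    a * Real.sqrt (b / a) = Real.sqrt (a * b) := by
  rw [← Real.sqrt_sq ha.le, ← Real.sqrt_mul (sq_nonneg _), Real.sqrt_sq ha.le]
  congr 1
  field_simp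


/-- Lemma 2.1(2), solitary wave (s-w-1) of the concentrated-nonlinearity Soler model:
the profile `φ(x) = α (1, μ(ω) sgn x) e^{-ϰ(ω)|x|}` solves the stationary Dirac system
`D_m φ = ω φ` away from the origin, and satisfies the jump condition
`iσ₂[φ]₀ = f(φ̂*σ₃φ̂) σ₃ φ̂` (with `[φ]₀ = (0, 2αμ)` and `φ̂ = (α,0)`)
if and only if `f(α²) = 2μ(ω)`. -/
theorem stmt_0 (m ω α : ℝ) (f : ℝ → ℝ)
    (hm : 0 < m) (hω : ω ∈ Set.Ioo (-m) m) (hα : 0 < α)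
    (ϰ μ : ℝ)
    (hϰ : ϰ = Real.sqrt (m ^ 2 - ω ^ 2))
    (hμ : μ = Real.sqrt ((m - ω) / (m + ω)))
    (v u : ℝ → ℝ)
    (hv : ∀ x : ℝ, v x = α * Real.exp (-(ϰ * |x|)))
    (hu : ∀ x : ℝ, u x = α * μ * Real.sign x * Real.exp (-(ϰ * |x|))) :
    (∀ x : ℝ, x ≠ 0 →
      (m - ω) * v x + deriv u x = 0 ∧ -(deriv v x) - (m + ω) * u x = 0)
    ∧ ((Matrix.mulVec !![(0 : ℝ), 1; -1, 0] ![0, 2 * α * μ]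
          = f (α ^ 2) • Matrix.mulVec !![(1 : ℝ), 0; 0, -1] ![α, 0])
        ↔ f (α ^ 2) = 2 * μ) := by
  have hp : 0 < m + ω := by linarith [hω.1]
  have hn : 0 < m - ω := by linarith [hω.2]
  have hϰμ : (m + ω) * μ = ϰ := by
    rw [hμ, hϰ, Real.mul_sqrt_div_self hp]
    ring_nf
  have hμ_sq : μ ^ 2 * (m + ω) = m - ω := by
    rw [hμ, Real.sq_sqrt (div_pos hn hp).le, div_mul_cancel₀ _ hp.ne']
  refine ⟨fun x hx => ?_, ?_⟩
  · have hE := hasDerivAt_exp_neg_mul_abs ϰ hx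
    have hs : Real.sign x * Real.sign x = 1 := by
      rcases Real.sign_apply_eq_of_ne_zero x hx with h | h <;> rw [h] <;> norm_num
    have hdv : deriv v x = α * (-(ϰ * Real.sign x) * Real.exp (-(ϰ * |x|))) := by
      rw [funext hv]
      exact (hE.const_mul α).deriv
    have hdu : deriv u x =
        α * μ * Real.sign x * (-(ϰ * Real.sign x) * Real.exp (-(ϰ * |x|))) := by
      refine HasDerivAt.deriv ((hE.const_mul (α * μ * Real.sign x)).congr_of_eventuallyEq ?_)
      filter_upwards [Real.sign_eventuallyEq hx] with y hy
      rw [hu, hy]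
    constructor
    · rw [hv, hdu, ← hϰμ, ← hμ_sq]
      linear_combination
        (-(α * μ ^ 2 * (m + ω) * Real.exp (-((m + ω) * μ * |x|)))) * hs
    · rw [hu, hdv, ← hϰμ]
      ring
  · have hcomp : Matrix.mulVec !![(0 : ℝ), 1; -1, 0] ![0, 2 * α * μ]
          = f (α ^ 2) • Matrix.mulVec !![(1 : ℝ), 0; 0, -1] ![α, 0]
        ↔ 2 * α * μ = f (α ^ 2) * α := by
      simp [funext_iff, Fin.forall_fin_two]
    rw [hcomp]
    constructor
    · intro h
      exact mul_right_cancel₀ hα.ne' (by linarith)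
    · intro h
      rw [h]
      ring
end

section
/- Let m>0, ω∈(−m,m), and let λ∈ℝ with −m−ω<λ<m−ω. Then the relation −(m+ω+λ) + μ(ω)·√((m−ω−λ)(m+ω+λ)) = 0 holds if and only if λ = −2ω. In particular the point λ=−2ω lies in the interval (−m−ω, m−ω). -/
/-- Lemma 3.2(2): for `λ` in the spectral gap `(-m-ω, m-ω)`, the jump relation
`-(m+ω+λ) + μ(ω)·√((m-ω-λ)(m+ω+λ)) = 0` holds iff `λ = -2ω`; moreover `-2ω` lies
in the gap. -/
theorem stmt_3 (m ω lam : ℝ) (hm : 0 < m) (hω : ω ∈ Set.Ioo (-m) m)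
    (hlam₁ : -m - ω < lam) (hlam₂ : lam < m - ω)
    (μ : ℝ) (hμ : μ = Real.sqrt ((m - ω) / (m + ω))) :
    (-(m + ω + lam) + μ * Real.sqrt ((m - ω - lam) * (m + ω + lam)) = 0 ↔ lam = -(2 * ω))
    ∧ (-m - ω < -(2 * ω) ∧ -(2 * ω) < m - ω) := by
  obtain ⟨h₁, h₂⟩ := hω
  have hs : 0 < m + ω := by linarith
  have hd : 0 < m - ω := by linarith
  have hA : 0 < m + ω + lam := by linarith
  refine ⟨?_, by linarith, by linarith⟩
  rw [hμ, ← Real.sqrt_mul (div_nonneg hd.le hs.le), neg_add_eq_zero, eq_comm,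
    Real.sqrt_eq_iff_mul_self_eq_of_pos hA, div_mul_eq_mul_div, eq_div_iff hs.ne']
  constructor
  · intro h
    have h' : (m + ω + lam) * (2 * m) * (lam + 2 * ω) = 0 := by linear_combination h
    have hne : (m + ω + lam) * (2 * m) ≠ 0 := by positivity
    linarith [(mul_eq_zero.mp h').resolve_left hne]
  · rintro rfl
    ring
end

section
/- Let m>0, ω∈(−m,m), κ∈ℝ, and let λ∈ℝ with −m−ω<λ<m−ω. Then the relation √((m−ω−λ)(m+ω+λ)) = (1+2κ)·μ(ω)·(m+ω+λ) holds if and only if 1+2κ>0 and λ = Z(ω,κ) := −4(m−ω)·κ(κ+1)/(1+(1+2κ)²μ(ω)²). -/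
/-- Lemma 3.2(3): for `λ` in the spectral gap `(-m-ω, m-ω)`, the jump relation
`√((m-ω-λ)(m+ω+λ)) = (1+2κ) μ(ω) (m+ω+λ)` holds iff `1+2κ > 0` and
`λ = Z(ω,κ) = -4(m-ω) κ(κ+1)/(1+(1+2κ)² μ(ω)²)`. -/
theorem stmt_4 (m ω κ lam : ℝ) (hm : 0 < m) (hω : ω ∈ Set.Ioo (-m) m)
    (hlam₁ : -m - ω < lam) (hlam₂ : lam < m - ω)
    (μ : ℝ) (hμ : μ = Real.sqrt ((m - ω) / (m + ω))) :
    Real.sqrt ((m - ω - lam) * (m + ω + lam)) = (1 + 2 * κ) * μ * (m + ω + lam)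
    ↔ (0 < 1 + 2 * κ ∧
        lam = -(4 * (m - ω)) * (κ * (κ + 1)) / (1 + (1 + 2 * κ) ^ 2 * μ ^ 2)) := by
  obtain ⟨hω₁, hω₂⟩ := hω
  have hsum : 0 < m + ω := by linarith
  have hdiff : 0 < m - ω := by linarith
  have hA : 0 < m - ω - lam := by linarith
  have hB : 0 < m + ω + lam := by linarith
  have hμ_pos : 0 < μ := hμ ▸ Real.sqrt_pos.mpr (div_pos hdiff hsum)
  have hμ_sq : μ ^ 2 * (m + ω) = m - ω := by
    rw [hμ, Real.sq_sqrt (div_pos hdiff hsum).le, div_mul_cancel₀ _ hsum.ne']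
  have hden : 1 + (1 + 2 * κ) ^ 2 * μ ^ 2 ≠ 0 := by positivity
  rw [eq_div_iff hden]
  constructor
  · intro h
    have hpos : 0 < (1 + 2 * κ) * μ * (m + ω + lam) :=
      h ▸ Real.sqrt_pos.mpr (mul_pos hA hB)
    refine ⟨pos_of_mul_pos_left (pos_of_mul_pos_left hpos hB.le) hμ_pos.le, ?_⟩
    rw [Real.sqrt_eq_iff_mul_self_eq_of_pos hpos] at h
    have hAB : m - ω - lam = (1 + 2 * κ) ^ 2 * μ ^ 2 * (m + ω + lam) :=
      mul_right_cancel₀ hB.ne' (by linear_combination -h)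
    linear_combination -hAB - (1 + 2 * κ) ^ 2 * hμ_sq
  · rintro ⟨hκ, h⟩
    rw [Real.sqrt_eq_iff_mul_self_eq_of_pos (by positivity)]
    linear_combination (m + ω + lam) * (h + (1 + 2 * κ) ^ 2 * hμ_sq)
end

section
/- Let m>0 and ω∈(−m,m), and define Z(ω,κ) = −4(m−ω)·κ(κ+1)/(1+(1+2κ)²μ(ω)²) for κ∈ℝ. Then: (i) Z(ω,κ)=Z(ω,−1−κ) for all κ (symmetry with respect to κ=−1/2); (ii) Z(ω,−1/2)=m−ω, Z(ω,0)=0, Z(ω,−1)=0, and Z(ω,−1/2 ± 1/(2μ(ω)²)) = −2ω; (iii) for every κ∈ℝ one has −m−ω < Z(ω,κ) ≤ m−ω, with equality Z(ω,κ)=m−ω only for κ=−1/2; and (iv) Z(ω,κ) → −m−ω as κ→+∞ and as κ→−∞. -/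
open Filter

/-- Lemma 3.2(3) and Remark 3.3: properties of the eigenvalue
`Z(ω,κ) = -4(m-ω) κ(κ+1)/(1+(1+2κ)² μ(ω)²)` of `L(ω,κ)`:
symmetry about `κ = -1/2`, the special values, confinement to the spectral gap
`(-m-ω, m-ω]` with equality only at `κ = -1/2`, and the limits `κ → ±∞`. -/
theorem stmt_5 (m ω : ℝ) (hm : 0 < m) (hω : ω ∈ Set.Ioo (-m) m)
    (μ : ℝ) (hμ : μ = Real.sqrt ((m - ω) / (m + ω)))
    (Z : ℝ → ℝ)
    (hZ : ∀ κ : ℝ, Z κ = -(4 * (m - ω)) * (κ * (κ + 1)) / (1 + (1 + 2 * κ) ^ 2 * μ ^ 2)) :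
    -- (i) symmetry with respect to κ = -1/2
    (∀ κ : ℝ, Z κ = Z (-1 - κ))
    -- (ii) special values
    ∧ Z (-(1 / 2)) = m - ω
    ∧ Z 0 = 0
    ∧ Z (-1) = 0
    ∧ Z (-(1 / 2) + 1 / (2 * μ ^ 2)) = -(2 * ω)
    ∧ Z (-(1 / 2) - 1 / (2 * μ ^ 2)) = -(2 * ω)
    -- (iii) Z stays in the spectral gap
    ∧ (∀ κ : ℝ, -m - ω < Z κ ∧ Z κ ≤ m - ω ∧ (Z κ = m - ω → κ = -(1 / 2)))
    -- (iv) limits as κ → ±∞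
    ∧ Tendsto Z atTop (nhds (-m - ω))
    ∧ Tendsto Z atBot (nhds (-m - ω)) := by
  obtain ⟨h1, h2⟩ := hω
  have ha : 0 < m - ω := by linarith
  have hb : 0 < m + ω := by linarith
  have hsq : μ ^ 2 = (m - ω) / (m + ω) := by
    rw [hμ, Real.sq_sqrt (div_pos ha hb).le]
  have hD : ∀ κ : ℝ, 0 < (m + ω) + (m - ω) * (1 + 2 * κ) ^ 2 := fun κ => by positivity
  have key : ∀ κ : ℝ, Z κ =
      -m - ω + (m + ω) * (2 * m) / ((m + ω) + (m - ω) * (1 + 2 * κ) ^ 2) := by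
    intro κ
    have hden : 1 + (1 + 2 * κ) ^ 2 * ((m - ω) / (m + ω)) =
        ((m + ω) + (m - ω) * (1 + 2 * κ) ^ 2) / (m + ω) := by
      field_simp
    have hne := (hD κ).ne'
    rw [hZ, hsq, hden, div_div_eq_mul_div, div_eq_iff hne, add_mul, div_mul_cancel₀ _ hne]
    ring
  have hsymm : ∀ κ : ℝ, Z κ = Z (-1 - κ) := by
    intro κ
    rw [key, key, show (1 + 2 * (-1 - κ)) ^ 2 = (1 + 2 * κ) ^ 2 by ring]
  have hplus : Z (-(1 / 2) + 1 / (2 * μ ^ 2)) = -(2 * ω) := by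
    have hs : 1 + 2 * (-(1 / 2) + 1 / (2 * μ ^ 2)) = (m + ω) / (m - ω) := by
      rw [hsq]
      field_simp
      ring
    have hden : (m + ω) + (m - ω) * ((m + ω) / (m - ω)) ^ 2 =
        (m + ω) * (2 * m) / (m - ω) := by
      field_simp
      ring
    rw [key, hs, hden, div_div_cancel₀ (by positivity)]
    ring
  have htop : Tendsto Z atTop (nhds (-m - ω)) := by
    have hlin : Tendsto (fun κ : ℝ => 1 + 2 * κ) atTop atTop :=
      tendsto_atTop_add_const_left _ _ (tendsto_id.const_mul_atTop two_pos)
    have hden : Tendsto (fun κ : ℝ => (m + ω) + (m - ω) * (1 + 2 * κ) ^ 2) atTop atTop :=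
      tendsto_atTop_add_const_left _ _
        (((tendsto_pow_atTop two_ne_zero).comp hlin).const_mul_atTop ha)
    have hlim := (hden.const_div_atTop ((m + ω) * (2 * m))).const_add (-m - ω)
    rw [add_zero] at hlim
    exact hlim.congr fun κ => (key κ).symm
  refine ⟨hsymm, ?_, ?_, ?_, hplus, ?_, ?_, htop, ?_⟩
  · rw [hZ]
    norm_num
    ring
  · simp [hZ]
  · simp [hZ]
  · rw [hsymm, ← hplus]
    congr 1
    ring
  · intro κ
    have hpos : 0 < (m + ω) * (2 * m) / ((m + ω) + (m - ω) * (1 + 2 * κ) ^ 2) :=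
      div_pos (by positivity) (hD κ)
    have hle : (m + ω) * (2 * m) / ((m + ω) + (m - ω) * (1 + 2 * κ) ^ 2) ≤ 2 * m := by
      rw [div_le_iff₀ (hD κ)]
      have : 0 ≤ (2 * m) * ((m - ω) * (1 + 2 * κ) ^ 2) := by positivity
      linarith
    rw [key]
    refine ⟨by linarith, by linarith, fun h => ?_⟩
    have heq : (m + ω) * (2 * m) / ((m + ω) + (m - ω) * (1 + 2 * κ) ^ 2) = 2 * m := by
      linarith
    rw [div_eq_iff (hD κ).ne'] at heq
    have hzero : (2 * m) * (m - ω) * (1 + 2 * κ) ^ 2 = 0 := by linarith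
    have hs : (1 + 2 * κ) ^ 2 = 0 := (mul_eq_zero.mp hzero).resolve_left (by positivity)
    have := pow_eq_zero_iff two_ne_zero |>.mp hs
    linarith
  · have hrefl : Tendsto (fun κ : ℝ => -1 - κ) atBot atTop :=
      tendsto_atTop_add_const_left _ (-1 : ℝ) tendsto_neg_atBot_atTop
    exact (htop.comp hrefl).congr fun κ => (hsymm κ).symm
end

section
/- Let m>0, κ∈ℝ∖{−1,0}, ω∈ℝ, and set a = m(κ+1)² − ωκ(κ+2), b = κ(m(κ+1) − ωκ), c = m(κ+1)² − ωκ(3κ+2), Ω_κ = m(κ+1)/(2κ), W_κ = m(2κ²+2κ+1)/(2κ(κ+1)), and D̃ = (m+ω)²a² − (m−ω)²c². Then 16·b²·ω²·(b²+ac)·(2Ω_κ−ω)²·(W_κ−ω) = (Ω_κ−ω)·D̃². -/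
/-- The squared form of the eigenvalue formula (lambda-plus)-(lambda-plus-minus) in the
proof of Theorem 3.4(4):
`16 b² ω² (b²+ac) (2Ω_κ-ω)² (W_κ-ω) = (Ω_κ-ω) D̃²`, where
`D̃ = (m+ω)²a² - (m-ω)²c²`. -/
theorem stmt_10 (m ω κ : ℝ) (hm : 0 < m) (hκ₁ : κ ≠ -1) (hκ₀ : κ ≠ 0)
    (a b c Ω W D : ℝ)
    (ha : a = m * (κ + 1) ^ 2 - ω * κ * (κ + 2))
    (hb : b = κ * (m * (κ + 1) - ω * κ))
    (hc : c = m * (κ + 1) ^ 2 - ω * κ * (3 * κ + 2))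
    (hΩ : Ω = m * (κ + 1) / (2 * κ))
    (hW : W = m * (2 * κ ^ 2 + 2 * κ + 1) / (2 * κ * (κ + 1)))
    (hD : D = (m + ω) ^ 2 * a ^ 2 - (m - ω) ^ 2 * c ^ 2) :
    16 * b ^ 2 * ω ^ 2 * (b ^ 2 + a * c) * (2 * Ω - ω) ^ 2 * (W - ω)
      = (Ω - ω) * D ^ 2 := by
  have hκ₂ : κ + 1 ≠ 0 := fun h => hκ₁ (by linarith)
  subst ha hb hc hΩ hW hD
  field_simp
  ring
end

section
/- Let m>0 and κ∈ℝ∖{0}. For ω∈(−m,m) define μ(ω)=√((m−ω)/(m+ω)), ϰ(ω)=√(m²−ω²), α(ω)² = (2μ(ω))^{1/κ} (the pure power nonlinearity f(τ)=|τ|^κ, so that α^{2κ}=2μ), and the charge Q(ω) = α(ω)²(1+μ(ω)²)/ϰ(ω). Then Q is differentiable on (−m,m) and Q′(ω) = (2m·α(ω)²/((m+ω)·ϰ(ω)³))·(2ω − m − m/κ). In particular, for ω∈(−m,m), Q′(ω)=0 if and only if ω = m(1+κ)/(2κ) = Ω_κ. -/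
theorem hasDerivAt_sqrt_sub_div_add {m ω : ℝ} (hω : ω ∈ Set.Ioo (-m) m) :
    HasDerivAt (fun x => √((m - x) / (m + x)))
      (-(m / (m ^ 2 - ω ^ 2)) * √((m - ω) / (m + ω))) ω := by
  have hp : 0 < m + ω := by linarith [hω.1]
  have hn : 0 < m - ω := by linarith [hω.2]
  have hq : 0 < (m - ω) / (m + ω) := div_pos hn hp
  have hd := ((((hasDerivAt_id ω).const_sub m).div ((hasDerivAt_id ω).const_add m) hp.ne').sqrt
    hq.ne')
  refine hd.congr_deriv ?_
  have hs : 0 < √((m - ω) / (m + ω)) := Real.sqrt_pos.2 hq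
  have hs2 : √((m - ω) / (m + ω)) ^ 2 = (m - ω) / (m + ω) := Real.sq_sqrt hq.le
  simp only [id, Pi.div_apply]
  rw [div_eq_iff (by positivity)]
  generalize √((m - ω) / (m + ω)) = s at hs2
  have : m ^ 2 - ω ^ 2 = (m - ω) * (m + ω) := by ring
  rw [this, show -(m / ((m - ω) * (m + ω))) * s * (2 * s)
    = -(m / ((m - ω) * (m + ω))) * 2 * s ^ 2 by ring, hs2]
  field_simp
  ring

theorem hasDerivAt_sqrt_sq_sub_sq {m ω : ℝ} (hω : 0 < m ^ 2 - ω ^ 2) :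
    HasDerivAt (fun x => √(m ^ 2 - x ^ 2)) (-ω / √(m ^ 2 - ω ^ 2)) ω := by
  have hd := (((hasDerivAt_id ω).pow 2).const_sub (m ^ 2)).sqrt hω.ne'
  refine hd.congr_deriv ?_
  have hs : 0 < √(m ^ 2 - ω ^ 2) := Real.sqrt_pos.2 hω
  simp only [id, Pi.pow_apply]
  field_simp
  norm_num

/-- Differentiating a power of a positive function multiplies its logarithmic derivative by the
exponent. -/
theorem HasDerivAt.rpow_const_of_logDeriv {f : ℝ → ℝ} {x c : ℝ} (p : ℝ)
    (hf : HasDerivAt f (c * f x) x) (hx : 0 < f x) :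
    HasDerivAt (fun y => f y ^ p) (p * c * f x ^ p) x := by
  refine (hf.rpow_const (p := p) (Or.inl hx.ne')).congr_deriv ?_
  rw [Real.rpow_sub_one hx.ne']
  field_simp


/-- The Kolokolov condition of Section 3.3: for the charge
`Q(ω) = α(ω)²(1+μ(ω)²)/ϰ(ω)` of the solitary wave with pure power nonlinearity
(`α² = (2μ)^{1/κ}`), one has
`Q′(ω) = (2mα²/((m+ω)ϰ³))(2ω - m - m/κ)` on `(-m,m)`, which vanishes exactly at
`ω = m(1+κ)/(2κ) = Ω_κ`. -/
theorem stmt_13 (m κ : ℝ) (hm : 0 < m) (hκ : κ ≠ 0)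
    (μ ϰ αsq Q : ℝ → ℝ)
    (hμ : ∀ ω : ℝ, μ ω = Real.sqrt ((m - ω) / (m + ω)))
    (hϰ : ∀ ω : ℝ, ϰ ω = Real.sqrt (m ^ 2 - ω ^ 2))
    (hαsq : ∀ ω : ℝ, αsq ω = (2 * μ ω) ^ (1 / κ))
    (hQ : ∀ ω : ℝ, Q ω = αsq ω * (1 + (μ ω) ^ 2) / ϰ ω) :
    ∀ ω ∈ Set.Ioo (-m) m,
      HasDerivAt Q
        (2 * m * αsq ω / ((m + ω) * (ϰ ω) ^ 3) * (2 * ω - m - m / κ)) ω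
      ∧ (2 * m * αsq ω / ((m + ω) * (ϰ ω) ^ 3) * (2 * ω - m - m / κ) = 0
          ↔ ω = m * (1 + κ) / (2 * κ)) := by
  intro ω hω
  have hp : 0 < m + ω := by linarith [hω.1]
  have hn : 0 < m - ω := by linarith [hω.2]
  have hk : 0 < m ^ 2 - ω ^ 2 := by nlinarith
  have hμpos : 0 < μ ω := hμ ω ▸ Real.sqrt_pos.2 (div_pos hn hp)
  have hϰpos : 0 < ϰ ω := hϰ ω ▸ Real.sqrt_pos.2 hk
  have hαpos : 0 < αsq ω := hαsq ω ▸ Real.rpow_pos_of_pos (by positivity) _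
  have hμsq : μ ω ^ 2 = (m - ω) / (m + ω) := by
    rw [hμ, Real.sq_sqrt (div_pos hn hp).le]
  have hϰsq : ϰ ω ^ 2 = (m - ω) * (m + ω) := by
    rw [hϰ, Real.sq_sqrt hk.le]
    ring
  have dμ : HasDerivAt μ (-(m / ϰ ω ^ 2) * μ ω) ω := by
    rw [hϰ, Real.sq_sqrt hk.le, hμ, funext hμ]
    exact hasDerivAt_sqrt_sub_div_add hω
  have dϰ : HasDerivAt ϰ (-ω / ϰ ω) ω := by
    rw [hϰ, funext hϰ]
    exact hasDerivAt_sqrt_sq_sub_sq hk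
  have dα : HasDerivAt αsq (1 / κ * -(m / ϰ ω ^ 2) * αsq ω) ω := by
    rw [hαsq, funext hαsq]
    refine HasDerivAt.rpow_const_of_logDeriv (f := fun x => 2 * μ x) (1 / κ) ?_ (by positivity)
    exact (dμ.const_mul 2).congr_deriv (by ring)
  constructor
  · rw [funext hQ]
    refine ((dα.mul ((dμ.pow 2).const_add 1)).div dϰ hϰpos.ne').congr_deriv ?_
    simp only [Pi.mul_apply, Pi.pow_apply]
    generalize αsq ω = a
    generalize ϰ ω = k at *
    generalize μ ω = u at *
    have hk3 : k ^ 3 = k * ((m - ω) * (m + ω)) := by rw [← hϰsq]; ring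
    have hu : u ^ (2 - 1) * (-(m / k ^ 2) * u) = -(m / k ^ 2) * u ^ 2 := by
      norm_num
      ring
    rw [mul_assoc _ (u ^ (2 - 1)), hu, hk3, hμsq, hϰsq]
    field_simp
    rw [hϰsq]
    push_cast
    ring
  · have hc : 2 * m * αsq ω / ((m + ω) * ϰ ω ^ 3) ≠ 0 := by positivity
    rw [mul_eq_zero, or_iff_right hc, eq_div_iff (by simpa using hκ)]
    field_simp
    constructor <;> intro h <;> linarith
end
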